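/- Every continuous character χ: Z_p^* → C_p^* is w-locally analytic for some rational w > 0; that is, there exists w > 0 such that χ extends to an analytic character on Z_p^*·(1 + p^w O_{C_p}), equivalently, the restriction of χ to 1 + p^m Z_p is given by x ↦ exp(c·log x) for some c ∈ C_p and some m ≥ 1. -/

import Mathlib

variable (p : ℕ) [Fact p.Prime]
variable (K : Type*) [NontriviallyNormedField K] [CompleteSpace K]
  [IsUltrametricDist K] [Algebra ℚ_[p] K]

/-- The `p`-adic exponential, defined by its power series (via `tsum`). -/
noncomputable def padicExp (z : K) : K :=
  ∑' n : ℕ, ((n.factorial : K)⁻¹) * z ^ n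

/-- The `p`-adic logarithm, defined by its power series around `1` (via `tsum`). -/
noncomputable def padicLog (z : K) : K :=
  ∑' n : ℕ, ((-1 : K) ^ n * ((n + 1 : ℕ) : K)⁻¹) * (z - 1) ^ (n + 1)


open Filter Topology NormedSpace

section NormBounds

variable {p : ℕ} [Fact p.Prime] {L : Type*} [NontriviallyNormedField L] [Algebra ℚ_[p] L]

theorem charZero_of_padicAlgebra (p : ℕ) [Fact p.Prime] (L : Type*) [Field L]
    [Algebra ℚ_[p] L] : CharZero L :=
  charZero_of_injective_algebraMap (algebraMap ℚ_[p] L).injective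

theorem norm_inv_factorial_le (hK : ∀ q : ℚ_[p], ‖algebraMap ℚ_[p] L q‖ = ‖q‖) (n : ℕ) :
    ‖((n.factorial : L))⁻¹‖ ≤ (p : ℝ) ^ n := by
  have hp : (1 : ℝ) ≤ p := mod_cast (Fact.out : p.Prime).one_le
  rw [← map_natCast (algebraMap ℚ_[p] L), ← map_inv₀, hK, norm_inv,
    Padic.norm_eq_zpow_neg_valuation (mod_cast n.factorial_ne_zero), Padic.valuation_natCast,
    ← zpow_neg, neg_neg, zpow_natCast]
  exact pow_le_pow_right₀ hp (padicValNat_factorial_le p n)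

theorem norm_natCast_le_one (hK : ∀ q : ℚ_[p], ‖algebraMap ℚ_[p] L q‖ = ‖q‖) (n : ℕ) :
    ‖(n : L)‖ ≤ 1 := by
  rw [← map_natCast (algebraMap ℚ_[p] L), hK]
  exact mod_cast Padic.norm_int_le_one (p := p) n

theorem norm_inv_natCast_le (hK : ∀ q : ℚ_[p], ‖algebraMap ℚ_[p] L q‖ = ‖q‖) (n : ℕ) :
    ‖((n : L))⁻¹‖ ≤ (p : ℝ) ^ n := by
  have : CharZero L := charZero_of_padicAlgebra p L
  cases n with
  | zero => simp
  | succ n =>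
    have h : ((n + 1 : ℕ) : L)⁻¹ = (((n + 1).factorial : L))⁻¹ * (n.factorial : L) := by
      rw [Nat.factorial_succ]
      have : (n.factorial : L) ≠ 0 := mod_cast n.factorial_ne_zero
      push_cast
      field_simp
    rw [h, norm_mul]
    exact (mul_le_of_le_one_right (norm_nonneg _) (norm_natCast_le_one hK _)).trans
      (norm_inv_factorial_le hK _)

end NormBounds

section PowerSeries

variable {𝕜 : Type*} [NontriviallyNormedField 𝕜]

theorem ofScalars_radius_pos_of_norm_le {c : ℕ → 𝕜} {C : ℝ} (hC : 0 < C)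
    (h : ∀ n, ‖c n‖ ≤ C ^ n) : 0 < (FormalMultilinearSeries.ofScalars 𝕜 c).radius := by
  lift C to NNReal using hC.le
  have hC' : 0 < C⁻¹ := inv_pos.2 (mod_cast hC)
  refine lt_of_lt_of_le (ENNReal.coe_pos.2 hC')
    (FormalMultilinearSeries.le_radius_of_bound _ 1 fun n => ?_)
  rw [FormalMultilinearSeries.ofScalars_norm, NNReal.coe_inv, inv_pow, ← div_eq_mul_inv]
  exact div_le_one_of_le₀ (h n) (by positivity)

theorem AnalyticAt.eventually_eq_of_deriv_eq_zero [CompleteSpace 𝕜] [CharZero 𝕜] {f : 𝕜 → 𝕜}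
    {x : 𝕜} (hf : AnalyticAt 𝕜 f x) (hd : deriv f =ᶠ[𝓝 x] 0) : ∀ᶠ y in 𝓝 x, f y = f x := by
  obtain ⟨q, r, hq⟩ := hf
  have hz : q.derivSeries = 0 := by
    refine hq.fderiv.hasFPowerSeriesAt.eq_zero_of_eventually ?_
    filter_upwards [hd] with y hy
    exact ContinuousLinearMap.ext_ring hy
  have hc : ∀ n, q.coeff (n + 1) = 0 := fun n => by
    have h := q.derivSeries_coeff_one n
    have h0 : (0 : FormalMultilinearSeries 𝕜 𝕜 (𝕜 →L[𝕜] 𝕜)).coeff n = 0 := rfl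
    rw [hz, h0, zero_apply, eq_comm, nsmul_eq_mul, mul_eq_zero] at h
    exact h.resolve_left (Nat.cast_ne_zero.2 n.succ_ne_zero)
  filter_upwards [hq.hasFPowerSeriesAt.eventually_hasSum_sub] with y hy
  refine hy.unique ?_
  rw [← hq.coeff_zero (fun _ => 0)]
  have h0 : q 0 (fun _ => 0) = q 0 (fun _ => y - x) := congrArg (q 0) (Subsingleton.elim _ _)
  rw [h0]
  refine hasSum_single 0 fun n hn => ?_
  obtain ⟨n, rfl⟩ := Nat.exists_eq_succ_of_ne_zero hn
  simp [hc]

end PowerSeries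

section ExpLog

variable {p : ℕ} [Fact p.Prime] {L : Type*} [NontriviallyNormedField L] [Algebra ℚ_[p] L]

theorem padicExp_eq_exp [CharZero L] : padicExp L = exp := by
  rw [exp_eq_tsum_div]
  ext z
  simp only [padicExp, div_eq_mul_inv, mul_comm]

theorem padicLog_one : padicLog L 1 = 0 := by
  simp [padicLog]

theorem expSeries_radius_pos_of_padicAlgebra
    (hK : ∀ q : ℚ_[p], ‖algebraMap ℚ_[p] L q‖ = ‖q‖) : 0 < (expSeries L L).radius := by
  rw [expSeries_eq_ofScalars]
  exact ofScalars_radius_pos_of_norm_le (mod_cast (Fact.out : p.Prime).pos)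
    (norm_inv_factorial_le hK)

variable (L) in
/-- The coefficients of the power series of `padicLog L (1 + z)`. -/
noncomputable def padicLogCoeff (n : ℕ) : L := (-1) ^ (n + 1) * (n : L)⁻¹

variable (L) in
/-- The power series of `padicLog L (1 + z)`. -/
noncomputable def padicLogSeries : FormalMultilinearSeries L L L :=
  FormalMultilinearSeries.ofScalars L (padicLogCoeff L)

theorem padicLogSeries_radius_pos
    (hK : ∀ q : ℚ_[p], ‖algebraMap ℚ_[p] L q‖ = ‖q‖) : 0 < (padicLogSeries L).radius :=
  ofScalars_radius_pos_of_norm_le (C := p) (mod_cast (Fact.out : p.Prime).pos) fun n => by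
    simpa [padicLogCoeff] using norm_inv_natCast_le hK n

theorem padicLogSeries_sum (z : L) : (padicLogSeries L).sum z = padicLog L (1 + z) := by
  have h : (padicLogSeries L).sum z = ∑' n : ℕ, padicLogCoeff L n * z ^ n := by
    simp [FormalMultilinearSeries.sum, padicLogSeries, mul_comm]
  rw [h, ← Function.Injective.tsum_eq (add_left_injective 1)]
  · simp [padicLog, padicLogCoeff, pow_succ]
  · intro n hn
    cases n with
    | zero => simp [padicLogCoeff] at hn
    | succ n => exact ⟨n, rfl⟩

variable [CompleteSpace L]

theorem hasFPowerSeriesOnBall_padicLog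
    (hK : ∀ q : ℚ_[p], ‖algebraMap ℚ_[p] L q‖ = ‖q‖) :
    HasFPowerSeriesOnBall (fun z => padicLog L (1 + z)) (padicLogSeries L) 0
      (padicLogSeries L).radius :=
  ((padicLogSeries L).hasFPowerSeriesOnBall (padicLogSeries_radius_pos hK)).congr
    fun z _ => padicLogSeries_sum z

theorem eventually_hasDerivAt_padicLog
    (hK : ∀ q : ℚ_[p], ‖algebraMap ℚ_[p] L q‖ = ‖q‖) :
    ∀ᶠ z in 𝓝 (0 : L), HasDerivAt (fun z => padicLog L (1 + z)) (1 + z)⁻¹ z := by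
  have : CharZero L := charZero_of_padicAlgebra p L
  have hF := hasFPowerSeriesOnBall_padicLog hK
  filter_upwards [hF.fderiv.hasFPowerSeriesAt.eventually_hasSum_sub,
    hF.analyticAt.eventually_analyticAt, Metric.ball_mem_nhds (0 : L) one_pos] with z hs ha hz
  convert! ha.differentiableAt.hasDerivAt using 1
  have hs1 := (ContinuousLinearMap.apply L L (1 : L)).hasSum hs
  have hg := hasSum_geometric_of_norm_lt_one (ξ := -z) (by simpa using hz)
  rw [sub_neg_eq_add] at hg
  refine hg.unique ?_
  convert! hs1 using 1
  ext n
  have h1 := (padicLogSeries L).derivSeries_coeff_one n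
  have h2 : ((n : L) + 1) ≠ 0 := Nat.cast_add_one_ne_zero n
  rw [padicLogSeries, FormalMultilinearSeries.coeff_ofScalars, ← padicLogSeries] at h1
  simp [h1, padicLogCoeff, neg_pow z n, pow_succ]
  field_simp

theorem eventually_exp_padicLog
    (hK : ∀ q : ℚ_[p], ‖algebraMap ℚ_[p] L q‖ = ‖q‖) :
    ∀ᶠ x in 𝓝 (1 : L), padicExp L (padicLog L x) = x := by
  have : CharZero L := charZero_of_padicAlgebra p L
  have hr := expSeries_radius_pos_of_padicAlgebra hK
  have hF := (hasFPowerSeriesOnBall_padicLog hK).analyticAt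
  have hL0 : padicLog L (1 + 0) = 0 := by simp [padicLog_one]
  have hcont : Tendsto (fun z : L => padicLog L (1 + z)) (𝓝 0) (𝓝 0) := by
    simpa [padicLog_one] using hF.continuousAt.tendsto
  have hne : ∀ᶠ z : L in 𝓝 0, 1 + z ≠ 0 :=
    (continuous_const.add continuous_id).continuousAt.eventually_ne (by simp)
  have hE : AnalyticAt L exp (padicLog L (1 + 0)) := by
    rw [hL0]; exact (hasFPowerSeriesAt_exp_zero_of_radius_pos hr).analyticAt
  have hG : AnalyticAt L (fun z => exp (padicLog L (1 + z)) / (1 + z)) 0 :=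
    (AnalyticAt.comp (f := fun z : L => padicLog L (1 + z)) hE hF).div
      (analyticAt_const.add analyticAt_id) (by simp)
  have hd : deriv (fun z => exp (padicLog L (1 + z)) / (1 + z)) =ᶠ[𝓝 0] 0 := by
    filter_upwards [eventually_hasDerivAt_padicLog hK,
      hcont.eventually (Metric.eball_mem_nhds 0 hr), hne] with z h1 h2 h3
    have h4 := ((hasDerivAt_exp_of_mem_ball h2).comp z h1).div
      ((hasDerivAt_id z).const_add 1) h3
    refine h4.deriv.trans ?_
    simp [h3]
  have h := hG.eventually_eq_of_deriv_eq_zero hd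
  have hsub : Tendsto (fun x : L => x - 1) (𝓝 1) (𝓝 0) := by
    simpa using (continuous_sub_right (1 : L)).tendsto 1
  filter_upwards [hsub.eventually h, hsub.eventually hne] with x hx hx0
  rw [add_sub_cancel] at hx hx0
  rw [hL0, exp_zero, add_zero, div_one, div_eq_one_iff_eq hx0] at hx
  rw [padicExp_eq_exp, hx]

theorem eventually_padicLog_exp
    (hK : ∀ q : ℚ_[p], ‖algebraMap ℚ_[p] L q‖ = ‖q‖) :
    ∀ᶠ z in 𝓝 (0 : L), padicLog L (padicExp L z) = z := by
  have : CharZero L := charZero_of_padicAlgebra p L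
  have hr := expSeries_radius_pos_of_padicAlgebra hK
  have hF := (hasFPowerSeriesOnBall_padicLog hK).analyticAt
  have hE := (hasFPowerSeriesAt_exp_zero_of_radius_pos hr).analyticAt
  rw [padicExp_eq_exp]
  have h0 : exp (0 : L) - 1 = 0 := by simp
  have hcont : Tendsto (fun z : L => exp z - 1) (𝓝 0) (𝓝 0) := by
    convert! (hE.continuousAt.sub (continuousAt_const (y := 1))).tendsto using 2
    exact h0.symm
  have hG : AnalyticAt L (fun z : L => padicLog L (1 + (exp z - 1)) - z) 0 :=
    (AnalyticAt.comp (g := fun z : L => padicLog L (1 + z)) (f := fun z : L => exp z - 1)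
      (h0.symm ▸ hF) (hE.sub analyticAt_const)).sub analyticAt_id
  have hd : deriv (fun z : L => padicLog L (1 + (exp z - 1)) - z) =ᶠ[𝓝 0] 0 := by
    filter_upwards [hcont.eventually (eventually_hasDerivAt_padicLog hK),
      Metric.eball_mem_nhds 0 hr, hE.continuousAt.eventually_ne (by simp : exp (0 : L) ≠ 0)]
      with z h1 h2 h3
    have h4 := (HasDerivAt.comp z h1 ((hasDerivAt_exp_of_mem_ball h2).sub_const 1)).sub
      (hasDerivAt_id z)
    refine h4.deriv.trans ?_
    simp [h3]
  filter_upwards [hG.eventually_eq_of_deriv_eq_zero hd] with z hz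
  simpa [padicLog_one, sub_eq_zero] using hz

end ExpLog

section LocalInverse

variable {p : ℕ} [Fact p.Prime] {L : Type*} [NontriviallyNormedField L] [Algebra ℚ_[p] L]
  [CompleteSpace L]

theorem eventually_padicLog_near_one (hK : ∀ q : ℚ_[p], ‖algebraMap ℚ_[p] L q‖ = ‖q‖)
    {r : ℝ} (hr : 0 < r) :
    ∀ᶠ x in 𝓝 (1 : L), ContinuousAt (padicLog L) x ∧ ‖padicLog L x‖ < r ∧
      padicExp L (padicLog L x) = x := by
  have hF := (hasFPowerSeriesOnBall_padicLog hK).analyticAt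
  have hsub : Tendsto (fun x : L => x - 1) (𝓝 1) (𝓝 0) := by
    simpa using (continuous_sub_right (1 : L)).tendsto 1
  have h0 : ∀ᶠ z in 𝓝 (0 : L), ‖padicLog L (1 + z)‖ < r :=
    hF.continuousAt.norm.eventually_lt continuousAt_const (by simpa [padicLog_one] using hr)
  filter_upwards [hsub.eventually h0, hsub.eventually hF.eventually_analyticAt,
    eventually_exp_padicLog hK] with x hx hc he
  rw [add_sub_cancel] at hx
  refine ⟨?_, hx, he⟩
  have h := ContinuousAt.comp (f := fun x : L => x - 1) (x := x) hc.continuousAt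
    (continuous_sub_right 1).continuousAt
  simpa [Function.comp_def] using h

theorem exists_radius_padicExp (hK : ∀ q : ℚ_[p], ‖algebraMap ℚ_[p] L q‖ = ‖q‖) :
    ∃ r > 0, ∀ z : L, ‖z‖ < r → padicLog L (padicExp L z) = z ∧ ContinuousAt (padicExp L) z ∧
      ∀ n : ℕ, padicExp L (n * z) = padicExp L z ^ n := by
  have : CharZero L := charZero_of_padicAlgebra p L
  have hr := expSeries_radius_pos_of_padicAlgebra hK
  obtain ⟨r, hr0, h⟩ := Metric.eventually_nhds_iff.1
    ((eventually_padicLog_exp hK).and (Metric.eball_mem_nhds (0 : L) hr))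
  simp only [dist_zero_right] at h
  refine ⟨r, hr0, fun z hz => ⟨(h hz).1, ?_, fun n => ?_⟩⟩
  · rw [padicExp_eq_exp]
    exact (hasDerivAt_exp_of_mem_ball (h hz).2).continuousAt
  · rw [padicExp_eq_exp]
    induction n with
    | zero => simp
    | succ n ih =>
      have hn : ‖(n : L) * z‖ < r := by
        rw [norm_mul]
        exact (mul_le_of_le_one_left (norm_nonneg _) (norm_natCast_le_one hK n)).trans_lt hz
      rw [Nat.cast_succ, add_mul, one_mul, exp_add_of_mem_ball (h hn).2 (h hz).2, ih, pow_succ]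

end LocalInverse

section PrincipalUnits

variable {p : ℕ} [Fact p.Prime]

theorem PadicInt.exists_pow_dvd_sub_one_add_pow {m : ℕ} (hm : 2 ≤ m) {u : ℤ_[p]}
    (hu : (p : ℤ_[p]) ^ m ∣ u - 1) (k : ℕ) :
    ∃ n : ℕ, (p : ℤ_[p]) ^ (m + k) ∣ u - (1 + (p : ℤ_[p]) ^ m) ^ n := by
  have hp := (Fact.out : p.Prime)
  induction k with
  | zero => exact ⟨0, by simpa using hu⟩
  | succ k ih =>
    obtain ⟨n, a, ha⟩ := ih
    have hm1 : m ≠ 0 := by omega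
    have hdvd : (p : ℤ_[p]) * p ^ m * p ∣ (p ^ m) ^ p := by
      rw [← pow_mul, ← pow_succ', ← pow_succ]
      exact pow_dvd_pow _ (by nlinarith [hp.two_le])
    obtain ⟨y, hy⟩ := ZMod.exists_one_add_mul_pow_prime_pow_eq (R := ℤ_[p]) (u := (p : ℤ_[p]) ^ m)
      (v := p) hp (dvd_pow_self _ hm1) hdvd 1 k
    rw [mul_one] at hy
    obtain ⟨j, e, he⟩ : ∃ j : ℕ, (p : ℤ_[p]) ∣ a - j :=
      ⟨a.appr 1, by simpa [Ideal.mem_span_singleton] using PadicInt.appr_spec 1 a⟩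
    obtain ⟨d, hd⟩ : (p : ℤ_[p]) ∣ (1 + (p : ℤ_[p]) ^ m) ^ n - 1 := by
      refine (dvd_pow_self _ hm1).trans ?_
      simpa using sub_dvd_pow_sub_pow (1 + (p : ℤ_[p]) ^ m) 1 n
    obtain ⟨b, hb⟩ := Polynomial.powAddExpansion (1 : ℤ_[p])
      ((p : ℤ_[p]) ^ k * (p : ℤ_[p]) ^ m * (1 + p * y)) j
    obtain ⟨m, rfl⟩ : ∃ i, m = i + 1 := Nat.exists_eq_succ_of_ne_zero hm1
    refine ⟨n + p ^ k * j, ?_⟩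
    rw [pow_add _ n, pow_mul, hy, hb, ← add_assoc, pow_succ (p : ℤ_[p]) (_ + k)]
    rw [sub_eq_iff_eq_add] at ha he hd
    have hu' : u = (1 + (p : ℤ_[p]) ^ (m + 1)) ^ n + p ^ (m + 1 + k) * a := by rw [ha, add_comm]
    rw [hu', hd, he]
    refine ⟨e - j * y - d * j * (1 + p * y)
      - (p * d + 1) * b * p ^ (m + k) * (1 + p * y) ^ 2, ?_⟩
    simp only [one_pow, mul_one]
    ring

/-- A principal unit is a limit of powers of the topological generator `1 + p ^ m`. -/
theorem PadicInt.exists_tendsto_one_add_pow {m : ℕ} (hm : 2 ≤ m) {u : ℤ_[p]}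
    (hu : (p : ℤ_[p]) ^ m ∣ u - 1) :
    ∃ n : ℕ → ℕ, Tendsto (fun k => (1 + (p : ℤ_[p]) ^ m) ^ n k) atTop (𝓝 u) := by
  choose n hn using PadicInt.exists_pow_dvd_sub_one_add_pow hm hu
  refine ⟨n, ?_⟩
  rw [tendsto_iff_norm_sub_tendsto_zero]
  have hp1 : ‖(p : ℤ_[p])‖ < 1 := PadicInt.norm_lt_one_iff_dvd _ |>.2 dvd_rfl
  refine squeeze_zero (fun _ => norm_nonneg _) (fun k => ?_)
    (tendsto_pow_atTop_nhds_zero_of_lt_one (norm_nonneg _) hp1)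
  obtain ⟨a, ha⟩ := hn k
  rw [norm_sub_rev, ha, pow_add, norm_mul, norm_mul, norm_pow, norm_pow]
  have h1 := pow_le_one₀ (n := m) (norm_nonneg _) hp1.le
  have h2 := PadicInt.norm_le_one a
  have h3 : 0 ≤ ‖(p : ℤ_[p])‖ ^ k := by positivity
  calc _ ≤ 1 * ‖(p : ℤ_[p])‖ ^ k * 1 := by gcongr
    _ = _ := by ring

end PrincipalUnits

/-- **Every continuous character of `ℤ_p^*` is locally analytic.**
Let `C_p`-like `K` be a complete nonarchimedean extension of `ℚ_p` (with compatible norm).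
Every continuous character `χ : ℤ_p^* → K^*` is `w`-locally analytic for some `w > 0`:
there exist `m ≥ 1` and a constant `c ∈ K` such that on the subgroup `1 + p^m ℤ_p` the
character is given by `x ↦ exp(c · log x)`. -/
theorem continuous_character_locally_analytic
    (hK : ∀ q : ℚ_[p], ‖algebraMap ℚ_[p] K q‖ = ‖q‖)
    (χ : ℤ_[p]ˣ →* Kˣ) (hχ : Continuous fun u : ℤ_[p]ˣ => ((χ u : Kˣ) : K)) :
    ∃ (m : ℕ) (c : K), 1 ≤ m ∧
      ∀ u : ℤ_[p]ˣ, ((u : ℤ_[p]) - 1) ∈ Ideal.span {(p : ℤ_[p]) ^ m} →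
        ((χ u : Kˣ) : K) =
          padicExp K (c * padicLog K (algebraMap ℚ_[p] K ((u : ℤ_[p]) : ℚ_[p]))) := by

  obtain ⟨r, hr0, hr⟩ := exists_radius_padicExp hK
  obtain ⟨δ, hδ0, hδ⟩ := Metric.eventually_nhds_iff.1 (eventually_padicLog_near_one hK hr0)
  have hemb : Topology.IsEmbedding (Units.val : ℤ_[p]ˣ → ℤ_[p]) :=
    Units.isOpenEmbedding_val.isEmbedding
  obtain ⟨ε, hε0, hε⟩ : ∃ ε > 0, ∀ u : ℤ_[p]ˣ, ‖(u : ℤ_[p]) - 1‖ < ε → dist (χ u : K) 1 < δ := by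
    have h : ∀ᶠ u in 𝓝 (1 : ℤ_[p]ˣ), dist (χ u : K) 1 < δ := by
      have h1 := hχ.tendsto 1
      simp only [map_one, Units.val_one] at h1
      exact h1.eventually (Metric.ball_mem_nhds 1 hδ0)
    rw [hemb.nhds_eq_comap, Units.val_one, (Metric.nhds_basis_ball.comap _).eventually_iff] at h
    obtain ⟨ε, hε0, hε⟩ := h
    exact ⟨ε, hε0, fun u hu => hε (by simpa [dist_eq_norm] using hu)⟩
  have hp1 : ‖(p : ℤ_[p])‖ < 1 := (PadicInt.norm_lt_one_iff_dvd _).2 dvd_rfl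
  obtain ⟨m, hm, hm2⟩ := (((tendsto_pow_atTop_nhds_zero_of_lt_one (norm_nonneg _) hp1).eventually
    (gt_mem_nhds (lt_min hε0 hδ0))).and (eventually_ge_atTop 2)).exists
  have hsmall : ∀ u : ℤ_[p], (p : ℤ_[p]) ^ m ∣ u - 1 → ‖u - 1‖ < min ε δ := by
    rintro u ⟨a, ha⟩
    rw [ha, norm_mul, norm_pow]
    exact (mul_le_of_le_one_right (by positivity) (PadicInt.norm_le_one a)).trans_lt hm
  let ι : ℤ_[p] →+* K := (algebraMap ℚ_[p] K).comp PadicInt.Coe.ringHom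
  have hι : ∀ x : ℤ_[p], ι x = algebraMap ℚ_[p] K (x : ℚ_[p]) := fun _ => rfl
  have hιnorm : ∀ x : ℤ_[p], ‖ι x‖ = ‖x‖ := fun x => by rw [hι, hK, PadicInt.norm_def]
  have hιc : Continuous ι := (AddMonoidHomClass.isometry_of_norm ι hιnorm).continuous
  have hlog : ∀ u : ℤ_[p], (p : ℤ_[p]) ^ m ∣ u - 1 → ContinuousAt (padicLog K) (ι u) ∧
      ‖padicLog K (ι u)‖ < r ∧ padicExp K (padicLog K (ι u)) = ι u := fun u hu => hδ <| by
    rw [dist_eq_norm, ← map_one ι, ← map_sub, hιnorm]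
    exact (hsmall u hu).trans_le (min_le_right _ _)
  have hgd : (p : ℤ_[p]) ^ m ∣ (1 + (p : ℤ_[p]) ^ m) - 1 := by simp
  obtain ⟨g, hg⟩ : IsUnit (1 + (p : ℤ_[p]) ^ m) :=
    IsLocalRing.isUnit_of_mem_nonunits_one_sub_self _ <| by
      rw [sub_add_cancel_left, PadicInt.mem_nonunits, norm_neg, norm_pow]
      exact pow_lt_one₀ (norm_nonneg _) hp1 (by omega)
  rw [← hg] at hgd
  obtain ⟨-, hℓr, hℓ⟩ := hlog g hgd
  obtain ⟨-, hlam_lt, hlam⟩ := hδ (hε g ((hsmall g hgd).trans_le (min_le_left _ _)))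
  set ℓ := padicLog K (ι g)
  set lam := padicLog K (χ g : K)
  have hℓ0 : ℓ ≠ 0 := fun h => by
    have h0 : padicExp K 0 = 1 := by simpa using (hr 0 (by simpa using hr0)).2.2 0
    rw [h, h0, ← map_one ι] at hℓ
    have h1 := (AddMonoidHomClass.isometry_of_norm ι hιnorm).injective hℓ
    rw [hg, left_eq_add] at h1
    exact pow_ne_zero m (Nat.cast_ne_zero.2 (Fact.out : p.Prime).ne_zero) h1
  have hnorm : ∀ (n : ℕ) (z : K), ‖(n : K) * z‖ ≤ ‖z‖ := fun n z => by
    rw [norm_mul]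
    exact mul_le_of_le_one_left (norm_nonneg _) (norm_natCast_le_one hK n)
  have hpow : ∀ n : ℕ, padicLog K (ι ((g : ℤ_[p]) ^ n)) = n * ℓ := fun n => by
    rw [map_pow, ← hℓ, ← (hr ℓ hℓr).2.2 n, (hr _ ((hnorm n ℓ).trans_lt hℓr)).1]
  have hcpow : ∀ n : ℕ, lam / ℓ * padicLog K (ι ((g : ℤ_[p]) ^ n)) = n * lam := fun n => by
    rw [hpow]
    field_simp
  refine ⟨m, lam / ℓ, by omega, fun u hu => ?_⟩
  rw [Ideal.mem_span_singleton] at hu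
  obtain ⟨n, hn⟩ := PadicInt.exists_tendsto_one_add_pow hm2 hu
  rw [← hg] at hn
  have hnu : Tendsto (fun k => g ^ n k) atTop (𝓝 u) :=
    hemb.tendsto_nhds_iff.2 (by simpa [Function.comp_def] using hn)
  have hlim : Tendsto (fun k => lam / ℓ * padicLog K (ι ((g : ℤ_[p]) ^ n k))) atTop
      (𝓝 (lam / ℓ * padicLog K (ι u))) :=
    ((hlog u hu).1.tendsto.comp ((hιc.tendsto _).comp hn)).const_mul _
  simp only [hcpow] at hlim
  have hle : ‖lam / ℓ * padicLog K (ι u)‖ ≤ ‖lam‖ :=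
    le_of_tendsto hlim.norm (Eventually.of_forall fun k => hnorm _ _)
  have hexp := (hr _ (hle.trans_lt hlam_lt)).2.1.tendsto.comp hlim
  refine tendsto_nhds_unique ((hχ.tendsto u).comp hnu) (hexp.congr fun k => ?_)
  simp [(hr lam hlam_lt).2.2, hlam]
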